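/- arXiv:1007.4886 — 2 statements merged into one kernel-verified Lean document; each statement's English description precedes it below -/
import Mathlib

section
/- Let G be a finite group with an automorphism τ ∈ Aut(G) such that τ² = 1. Then the following are equivalent: (i) the function χ : G → ℚ defined by χ(g) = #{u ∈ G : u·τ(u) = g} is the multiplicity-free sum of all irreducible complex characters of G; (ii) for every irreducible character ψ of G, (1/|G|)·∑_{g ∈ G} ψ(g·τ(g)) = 1; (iii) ∑_{ψ ∈ Irr(G)} ψ(1) = #{ω ∈ G : ω·τ(ω) = 1}. -/
open scoped Classical BigOperators
open CategoryTheory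

noncomputable section

/-- The twisted centralizer of `ω` under `τ`-twisted conjugation. -/
def twistedCent {G : Type*} [Group G] (τ : G ≃* G) (ω : G) : Subgroup G where
  carrier := {g | g * ω * (τ g)⁻¹ = ω}
  one_mem' := by simp
  mul_mem' := by
    intro a b ha hb
    simp only [Set.mem_setOf_eq] at ha hb ⊢
    have h : a * b * ω * (τ (a * b))⁻¹ = a * (b * ω * (τ b)⁻¹) * (τ a)⁻¹ := by
      simp only [map_mul, mul_inv_rev]
      group
    rw [h, hb, ha]
  inv_mem' := by
    intro a ha
    simp only [Set.mem_setOf_eq] at ha ⊢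
    rw [map_inv, inv_inv]
    conv_lhs => rw [← ha]
    group

/-- The set of irreducible complex characters of `G`. -/
def irrCharSet (G : Type) [Group G] : Set (G → ℂ) :=
  {χ | ∃ V : FDRep ℂ G, Simple V ∧ χ = fun g => FDRep.character V g}

/-- The induced character of `lam : H → ℂ`, via the Frobenius formula. -/
def indChar {G : Type} [Group G] [Fintype G] (H : Subgroup G) (lam : H → ℂ) (g : G) : ℂ :=
  (Nat.card H : ℂ)⁻¹ * ∑ x : G, if h : x⁻¹ * g * x ∈ H then lam ⟨x⁻¹ * g * x, h⟩ else 0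

/-- `G` has a generalized involution model with respect to `τ`. -/
def HasGIMwrt (G : Type) [Group G] [Fintype G] (τ : G ≃* G) : Prop :=
  ∃ (R : Finset G) (lam : ∀ ω : G, twistedCent τ ω →* ℂ),
    (∀ ω ∈ R, ω * τ ω = 1) ∧
    (∀ v : G, v * τ v = 1 → ∃! ω, ω ∈ R ∧ ∃ g : G, g * v * (τ g)⁻¹ = ω) ∧
    (∀ x : G, (∑ ω ∈ R, indChar (twistedCent τ ω) (fun h => lam ω h) x) =
      ∑ᶠ ψ ∈ irrCharSet G, ψ x)

/-- `G` has a generalized involution model. -/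
def HasGIM (G : Type) [Group G] [Fintype G] : Prop :=
  ∃ τ : G ≃* G, (∀ g, τ (τ g) = g) ∧ HasGIMwrt G τ

end

open scoped MonoidAlgebra in
theorem bg_smul_zero {G : Type} [Group G] [Fintype G] (f : G → ℂ)
    (h0 : ∀ ψ ∈ irrCharSet G, ∑ g, f g * ψ g = 0)
    (z : ℂ[G]) (hz : z = ∑ g, MonoidAlgebra.single g (f g))
    (hzc : ∀ h : G, MonoidAlgebra.of ℂ G h * z = z * MonoidAlgebra.of ℂ G h)
    (M : Type) [AddCommGroup M] [Module ℂ M] [Module ℂ[G] M] [IsScalarTower ℂ ℂ[G] M] [hs : IsSimpleModule ℂ[G] M] (m : M) :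
    z • m = 0 := by
  have hinv : Invertible (Nat.card G : ℂ) := invertibleOfNonzero (NeZero.ne _)
  let ρ : Representation ℂ G M := Representation.ofModule' (k := ℂ) (G := G) M
  have hρ : ∀ (r : ℂ[G]) (x : M), ρ.asAlgebraHom r x = r • x := by
    intro r x
    simp [ρ, Representation.asAlgebraHom, Representation.ofModule']
  let eqv : ρ.asModule ≃ₗ[ℂ[G]] M :=
    { ρ.asModuleEquiv with
      map_smul' := fun r x => hρ r (ρ.asModuleEquiv x) }
  have hirr : ρ.IsIrreducible :=
    (Representation.irreducible_iff_isSimpleModule_asModule ρ).mpr (IsSimpleModule.congr eqv)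
  have hfd : FiniteDimensional ℂ M := by
    have : Module.Finite ℂ ℂ[G] := inferInstance
    exact Module.Finite.trans ℂ[G] M
  have hmem : ρ.character ∈ irrCharSet G := by
    refine ⟨FDRep.of ρ, ?_, rfl⟩
    rw [FDRep.simple_iff_char_is_norm_one]
    have := Representation.char_orthonormal ρ ρ
    rw [if_pos ⟨Representation.Equiv.refl ρ⟩] at this
    have h2 := eq_of_inv_mul_eq_one this
    exact_mod_cast h2.symm
  have hcomm : ∀ g, ρ.asAlgebraHom z ∘ₗ ρ g = ρ g ∘ₗ ρ.asAlgebraHom z := by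
    intro g
    have := congrArg ρ.asAlgebraHom (hzc g)
    rw [map_mul, map_mul, Representation.asAlgebraHom_of] at this
    exact this.symm
  obtain ⟨c, hc⟩ :=
    (Representation.IsIrreducible.algebraMap_intertwiningMap_bijective_of_isAlgClosed (ρ := ρ)).2
      ⟨ρ.asAlgebraHom z, hcomm⟩
  have hc' : ρ.asAlgebraHom z = c • LinearMap.id := by
    have := congrArg (fun x => x.toLinearMap) hc
    exact this.symm
  have htr : LinearMap.trace ℂ _ (ρ.asAlgebraHom z) = 0 := by
    rw [← h0 _ hmem]
    simp [hz, Representation.character]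
  have hn : Nontrivial M := IsSimpleModule.nontrivial ℂ[G] M
  rw [hc', map_smul, LinearMap.trace_id, smul_eq_mul, mul_eq_zero] at htr
  have hc0 : c = 0 := by
    rcases htr with h | h
    · exact h
    · exact absurd (Nat.cast_eq_zero.mp h) (Module.finrank_pos).ne'
  rw [hc0, zero_smul] at hc'
  rw [← hρ, hc', LinearMap.zero_apply]

open scoped MonoidAlgebra in
theorem bg_complete_aux {G : Type} [Group G] [Fintype G] (f : G → ℂ)
    (hf : ∀ g h, f (h * g * h⁻¹) = f g)
    (h0 : ∀ ψ ∈ irrCharSet G, ∑ g, f g * ψ g = 0) : f = 0 := by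
  set z : ℂ[G] := ∑ g, MonoidAlgebra.single g (f g) with hz
  have hzc : ∀ h : G, MonoidAlgebra.of ℂ G h * z = z * MonoidAlgebra.of ℂ G h := by
    intro h
    simp only [hz, Finset.mul_sum, Finset.sum_mul, MonoidAlgebra.of_apply,
      MonoidAlgebra.single_mul_single, one_mul, mul_one]
    refine Fintype.sum_equiv (MulAut.conj h).toEquiv _ _ fun g => ?_
    simp [hf]
  suffices hz0 : z = 0 by
    funext g
    have := congrArg (fun w : ℂ[G] => w.coeff g) hz0
    simpa [hz, Finsupp.finsetSum_apply, Finsupp.single_apply] using this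
  have hj : Ring.jacobson ℂ[G] = ⊥ := IsSemisimpleRing.jacobson_eq_bot _
  have : z ∈ Ring.jacobson ℂ[G] := by
    refine Submodule.mem_sInf.mpr fun I hI => ?_
    have hs : IsSimpleModule ℂ[G] (ℂ[G] ⧸ I) := isSimpleModule_iff_isCoatom.mpr hI
    have h2 := bg_smul_zero f h0 z hz hzc (ℂ[G] ⧸ I) (Submodule.Quotient.mk 1)
    rw [← Submodule.Quotient.mk_smul, Submodule.Quotient.mk_eq_zero] at h2
    simpa using h2
  rw [hj] at this
  simpa using this

theorem bg_simple_of_norm {G : Type} [Group G] [Fintype G] {ψ : G → ℂ} (hψ : ψ ∈ irrCharSet G) :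
    ∑ g, ψ g * ψ g⁻¹ = Fintype.card G := by
  obtain ⟨V, hV, rfl⟩ := hψ
  have := (FDRep.simple_iff_char_is_norm_one V).1 hV
  simpa using this

theorem bg_orth {G : Type} [Group G] [Fintype G] {ψ φ : G → ℂ} (hψ : ψ ∈ irrCharSet G)
    (hφ : φ ∈ irrCharSet G) :
    ∑ g, ψ g * φ g⁻¹ = if ψ = φ then (Fintype.card G : ℂ) else 0 := by
  have hinv : Invertible (Nat.card G : ℂ) := invertibleOfNonzero (NeZero.ne _)
  split_ifs with h
  · subst h; exact bg_simple_of_norm hψ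
  · obtain ⟨V, hV, rfl⟩ := hψ
    obtain ⟨W, hW, rfl⟩ := hφ
    have := FDRep.char_orthonormal V W
    rw [if_neg] at this
    · simpa using this
    · rintro ⟨i⟩
      exact h (FDRep.char_iso i)

theorem bg_finite (G : Type) [Group G] [Fintype G] : (irrCharSet G).Finite := by
  have : LinearIndependent ℂ (fun x : irrCharSet G => (x : G → ℂ)) := by
    rw [linearIndependent_iff']
    intro s c hc i hi
    have h1 : ∑ g, (∑ j ∈ s, c j • (j : G → ℂ)) g * (i : G → ℂ) g⁻¹ = 0 := by
      rw [hc]; simp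
    simp only [Finset.sum_apply, Pi.smul_apply, smul_eq_mul, Finset.sum_mul, mul_assoc] at h1
    rw [Finset.sum_comm] at h1
    simp only [← Finset.mul_sum, bg_orth (Subtype.prop _) i.2] at h1
    simpa [Subtype.coe_inj, hi] using h1
  exact this.setFinite

theorem bg_expand {G : Type} [Group G] [Fintype G] (hfin : (irrCharSet G).Finite) (f : G → ℂ)
    (hf : ∀ g h, f (h * g * h⁻¹) = f g) (g : G) :
    f g = ∑ ψ ∈ hfin.toFinset, ((Fintype.card G : ℂ)⁻¹ * ∑ h, f h * ψ h⁻¹) * ψ g := by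
  have hcard : (Fintype.card G : ℂ) ≠ 0 := NeZero.ne _
  set F : G → ℂ := fun g =>
    f g - ∑ ψ ∈ hfin.toFinset, ((Fintype.card G : ℂ)⁻¹ * ∑ h, f h * ψ h⁻¹) * ψ g with hF
  have hcl : ∀ ψ ∈ irrCharSet G, ∀ g h, ψ (h * g * h⁻¹) = ψ g := by
    rintro _ ⟨V, hV, rfl⟩ g h
    exact FDRep.char_conj V g h
  have hF0 : (fun g => F g⁻¹) = 0 := by
    apply bg_complete_aux
    · intro g h
      have e : (h * g * h⁻¹)⁻¹ = h * g⁻¹ * h⁻¹ := by group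
      simp only [hF, e, hf]
      congr 1
      refine Finset.sum_congr rfl fun ψ hψ => ?_
      rw [hcl ψ (hfin.mem_toFinset.1 hψ)]
    · intro φ hφ
      rw [← Equiv.sum_comp (Equiv.inv G)]
      simp only [Equiv.inv_apply, inv_inv, hF, sub_mul, Finset.sum_sub_distrib, Finset.sum_mul]
      rw [Finset.sum_comm]
      simp only [mul_assoc]
      simp only [← Finset.mul_sum]
      rw [Finset.sum_congr rfl (g := fun ψ => if ψ = φ then (∑ h, f h * φ h⁻¹) * (Fintype.card G : ℂ) else 0)]
      · simp only [Finset.sum_ite_eq', hfin.mem_toFinset, hφ, if_true]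
        field_simp
        ring
      · intro ψ hψ
        rw [bg_orth (hfin.mem_toFinset.1 hψ) hφ]
        split_ifs with h
        · subst h; rfl
        · simp
  have := congrFun hF0 g⁻¹
  simp only [inv_inv, hF, Pi.zero_apply] at this
  exact sub_eq_zero.mp this
open scoped TensorProduct

theorem bg_idem_trace {W : Type} [AddCommGroup W] [Module ℂ W] [FiniteDimensional ℂ W]
    (P : Module.End ℂ W) (hP : IsIdempotentElem P) : ∃ n : ℕ, LinearMap.trace ℂ W P = n :=
  ⟨_, ((LinearMap.isProj_range_iff_isIdempotentElem P).2 hP).trace⟩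

theorem bg_swap_trace {V : Type} [AddCommGroup V] [Module ℂ V] [FiniteDimensional ℂ V]
    (A B : Module.End ℂ V) :
    LinearMap.trace ℂ (V ⊗[ℂ] V)
      (TensorProduct.map A B * (TensorProduct.comm ℂ V V).toLinearMap) =
      LinearMap.trace ℂ V (A * B) := by
  let b := Module.finBasis ℂ V
  rw [LinearMap.trace_eq_matrix_trace ℂ (b.tensorProduct b), LinearMap.trace_eq_matrix_trace ℂ b,
    LinearMap.toMatrix_mul b]
  simp only [Matrix.trace, Matrix.diag, Matrix.mul_apply, LinearMap.toMatrix_apply,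
    Fintype.sum_prod_type, Module.Basis.tensorProduct_apply, Module.End.mul_apply,
    LinearEquiv.coe_coe, TensorProduct.comm_tmul, TensorProduct.map_tmul,
    Module.Basis.tensorProduct_repr_tmul_apply, smul_eq_mul]
  refine Finset.sum_congr rfl fun i _ => Finset.sum_congr rfl fun j _ => ?_
  ring

theorem bg_eps {G : Type} [Group G] [Fintype G] (τ : G ≃* G) (hτ : ∀ g, τ (τ g) = g)
    (ψ : G → ℂ) (hψ : ψ ∈ irrCharSet G) :
    ∃ r : ℝ, r ≤ 1 ∧ (Fintype.card G : ℂ)⁻¹ * ∑ g : G, ψ (g * τ g) = r := by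
  have hcard : (Fintype.card G : ℂ) ≠ 0 := NeZero.ne _
  have hnorm := bg_simple_of_norm hψ
  obtain ⟨V, hV, rfl⟩ := hψ
  -- the trace of the averaging projection is at most one
  have hd : (fun g => V.character g⁻¹) ∈ irrCharSet G := by
    refine ⟨FDRep.of (Representation.dual V.ρ), ?_, ?_⟩
    · rw [FDRep.simple_iff_char_is_norm_one]
      simp only [FDRep.char_dual, Nat.card_eq_fintype_card, ← hnorm, inv_inv]
      exact Finset.sum_congr rfl fun g _ => mul_comm _ _
    · funext g; rw [FDRep.char_dual]
  have ht : (fun g => V.character (τ g)) ∈ irrCharSet G := by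
    refine ⟨FDRep.of (V.ρ.comp τ.toMonoidHom), ?_, rfl⟩
    rw [FDRep.simple_iff_char_is_norm_one]
    change ∑ g, V.character (τ g) * V.character (τ g⁻¹) = _
    rw [Nat.card_eq_fintype_card, ← hnorm]
    refine Fintype.sum_equiv τ.toEquiv _ _ fun g => ?_
    simp
  have horth := bg_orth ht hd
  simp only [inv_inv] at horth
  let R : G →* Module.End ℂ (V ⊗[ℂ] V) :=
    { toFun := fun g => TensorProduct.map (V.ρ g) (V.ρ (τ g))
      map_one' := by simp
      map_mul' := fun g h => by
        rw [map_mul, map_mul, map_mul, TensorProduct.map_mul] }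
  let S : Module.End ℂ (V ⊗[ℂ] V) := (TensorProduct.comm ℂ V V).toLinearMap
  have hS : S * S = 1 := by
    ext x y; simp [S]
  have hRS : ∀ g, S * R g = R (τ g) * S := by
    intro g
    ext x y; simp [S, R, hτ]
  let P : Module.End ℂ (V ⊗[ℂ] V) := (Fintype.card G : ℂ)⁻¹ • ∑ g, R g
  have hRP : ∀ g, R g * P = P := by
    intro g
    simp only [P, mul_smul_comm, Finset.mul_sum, ← map_mul]
    congr 1
    exact Fintype.sum_equiv (Equiv.mulLeft g) _ _ fun h => rfl
  have hPP : P * P = P := by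
    conv_lhs => enter [1]; simp only [P]
    rw [smul_mul_assoc, Finset.sum_mul]
    simp only [hRP, Finset.sum_const, Finset.card_univ]
    rw [← Nat.cast_smul_eq_nsmul ℂ, smul_smul, inv_mul_cancel₀ hcard, one_smul]
  have hSP : S * P = P * S := by
    simp only [P, mul_smul_comm, smul_mul_assoc, Finset.mul_sum, Finset.sum_mul, hRS]
    congr 1
    exact Fintype.sum_equiv τ.toEquiv _ _ fun h => rfl
  have htrP : LinearMap.trace ℂ _ P =
      (Fintype.card G : ℂ)⁻¹ * ∑ g, V.character (τ g) * V.character g := by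
    simp only [P, map_smul, map_sum, smul_eq_mul]
    congr 1
    refine Finset.sum_congr rfl fun g _ => ?_
    rw [mul_comm]
    exact LinearMap.trace_tensorProduct' _ _
  have htrPS : LinearMap.trace ℂ _ (P * S) =
      (Fintype.card G : ℂ)⁻¹ * ∑ g, V.character (g * τ g) := by
    simp only [P, map_smul, map_sum, smul_eq_mul, smul_mul_assoc, Finset.sum_mul]
    congr 1
    refine Finset.sum_congr rfl fun g _ => ?_
    refine (bg_swap_trace (V.ρ g) (V.ρ (τ g))).trans ?_
    rw [← map_mul]; rfl
  have key : ∀ s : ℂ, s * s = 1 →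
      IsIdempotentElem ((2⁻¹ : ℂ) • (P + s • (P * S))) := by
    intro s hs
    have h1 : P * (P * S) = P * S := by rw [← mul_assoc, hPP]
    have h2 : (P * S) * P = P * S := by rw [mul_assoc, hSP, h1]
    have h3 : (P * S) * (P * S) = P := by
      rw [← mul_assoc, h2, mul_assoc, hS, mul_one]
    clear_value P
    unfold IsIdempotentElem
    have h4 : (P + s • (P * S)) * (P + s • (P * S)) = (2 : ℂ) • (P + s • (P * S)) := by
      simp only [mul_add, add_mul, mul_smul_comm, smul_mul_assoc, hPP, h1, h2, h3]
      linear_combination (norm := module) hs • P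
    rw [smul_mul_smul_comm, h4, smul_smul]
    norm_num
  obtain ⟨a, ha⟩ := bg_idem_trace _ (key 1 (by norm_num))
  obtain ⟨b, hb⟩ := bg_idem_trace _ (key (-1) (by norm_num))
  simp only [map_smul, map_add, smul_eq_mul, one_mul] at ha hb
  have hle : ((a : ℂ) + b = 1) ∨ ((a : ℂ) + b = 0) := by
    have : (a : ℂ) + b = LinearMap.trace ℂ _ P := by rw [← ha, ← hb]; ring
    rw [this, htrP, horth]
    split_ifs
    · left; exact inv_mul_cancel₀ hcard
    · right; simp
  refine ⟨(a : ℝ) - b, ?_, ?_⟩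
  · have : a ≤ 1 := by
      rcases hle with h | h <;> norm_cast at h <;> omega
    have h1 : (a : ℝ) ≤ 1 := by exact_mod_cast this
    have h2 : (0 : ℝ) ≤ b := Nat.cast_nonneg b
    linarith
  · rw [← htrPS]
    push_cast
    rw [← ha, ← hb]; ring

theorem bump_ginzburg_tfae (G : Type) [Group G] [Fintype G]
    (τ : G ≃* G) (hτ : ∀ g, τ (τ g) = g) :
    List.TFAE
      [∀ g : G, (Nat.card {u : G // u * τ u = g} : ℂ) = ∑ᶠ ψ ∈ irrCharSet G, ψ g,
       ∀ ψ ∈ irrCharSet G, (Fintype.card G : ℂ)⁻¹ * ∑ g : G, ψ (g * τ g) = 1,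
       (∑ᶠ ψ ∈ irrCharSet G, ψ 1) = (Nat.card {ω : G // ω * τ ω = 1} : ℂ)] := by
  have hcard : (Fintype.card G : ℂ) ≠ 0 := NeZero.ne _
  have hfin := bg_finite G
  set N : G → ℂ := fun g => (Nat.card {u : G // u * τ u = g} : ℂ) with hN
  have hfs : ∀ g : G, ∑ᶠ ψ ∈ irrCharSet G, ψ g = ∑ ψ ∈ hfin.toFinset, ψ g := fun g =>
    finsum_mem_eq_finite_toFinset_sum _ hfin
  have hNcl : ∀ g h, N (h * g * h⁻¹) = N g := by
    intro g h
    simp only [hN]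
    congr 1
    symm
    refine Nat.card_congr
      { toFun := fun u => ⟨h * u.1 * (τ h)⁻¹, ?_⟩
        invFun := fun u => ⟨h⁻¹ * u.1 * τ h, ?_⟩
        left_inv := fun u => ?_
        right_inv := fun u => ?_ }
    · have := u.2
      simp only [map_mul, map_inv, hτ]
      calc _ = h * (u.1 * τ u.1) * h⁻¹ := by group
        _ = _ := by rw [this]
    · have := u.2
      simp only [map_mul, map_inv, hτ]
      calc _ = h⁻¹ * (u.1 * τ u.1) * h := by group
        _ = g := by rw [this]; group
    · ext; simp only; group
    · ext; simp only; group
  have hNinv : ∀ g, N g⁻¹ = N g := by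
    intro g
    simp only [hN]
    congr 1
    have aux : ∀ u g : G, u * τ u = g → (τ u)⁻¹ * τ ((τ u)⁻¹) = g⁻¹ := by
      intro u g hu
      rw [← hu, map_inv, hτ, mul_inv_rev]
    refine Nat.card_congr
      { toFun := fun u => ⟨(τ u.1)⁻¹, by simpa using aux u.1 _ u.2⟩
        invFun := fun u => ⟨(τ u.1)⁻¹, aux u.1 _ u.2⟩
        left_inv := fun u => ?_
        right_inv := fun u => ?_ }
    · ext; simp [hτ]
    · ext; simp [hτ]
  have hsum : ∀ ψ : G → ℂ, ∑ g, ψ (g * τ g) = ∑ g, N g * ψ g⁻¹ := by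
    intro ψ
    have h1 : ∑ g, N g * ψ g⁻¹ = ∑ g, N g * ψ g := by
      rw [← Equiv.sum_comp (Equiv.inv G)]
      simp [hNinv]
    rw [h1, ← Finset.sum_fiberwise (s := Finset.univ) (g := fun g => g * τ g)]
    refine Finset.sum_congr rfl fun g _ => ?_
    rw [Finset.sum_congr rfl (g := fun _ => ψ g)
      (fun x hx => by rw [(Finset.mem_filter.1 hx).2])]
    simp [hN, Nat.card_eq_fintype_card, Fintype.card_subtype]
  have hexp := bg_expand hfin N hNcl
  simp only [← hsum] at hexp
  tfae_have 2 → 1 := by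
    intro h g
    rw [hfs]
    refine (hexp g).trans (Finset.sum_congr rfl fun ψ hψ => ?_)
    rw [h ψ (hfin.mem_toFinset.1 hψ), one_mul]
  tfae_have 1 → 3 := fun h => (h 1).symm
  tfae_have 3 → 2 := by
    intro h ψ hψ
    rw [hfs] at h
    have h1 := h.trans (hexp 1)
    have hpos : ∀ φ ∈ irrCharSet G, ∃ d : ℝ, 0 < d ∧ φ 1 = d := by
      intro φ hφ
      have hnorm := bg_simple_of_norm hφ
      obtain ⟨V, hV, rfl⟩ := hφ
      refine ⟨(Module.finrank ℂ V : ℝ), ?_, by simp⟩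
      rw [Nat.cast_pos, Nat.pos_iff_ne_zero]
      intro h0
      have : Subsingleton V := Module.finrank_zero_iff.1 h0
      have hz : ∀ g, V.character g = 0 := fun g => by
        rw [FDRep.character, Subsingleton.elim (V.ρ g) 0, map_zero]
      simp only [hz, mul_zero, Finset.sum_const_zero] at hnorm
      exact hcard hnorm.symm
    choose! d hd using hpos
    have he := fun φ hφ => bg_eps τ hτ φ hφ
    choose! e he using he
    have h2 : ∑ φ ∈ hfin.toFinset, (1 - e φ) * d φ = 0 := by
      have : ((∑ φ ∈ hfin.toFinset, (1 - e φ) * d φ : ℝ) : ℂ) = 0 := by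
        push_cast
        simp only [sub_mul, one_mul, Finset.sum_sub_distrib]
        rw [sub_eq_zero]
        rw [Finset.sum_congr rfl (fun φ hφ => (hd φ (hfin.mem_toFinset.1 hφ)).2)] at h1
        rw [h1]
        refine Finset.sum_congr rfl fun φ hφ => ?_
        have hφ' := hfin.mem_toFinset.1 hφ
        rw [(he φ hφ').2, (hd φ hφ').2]
      exact_mod_cast this
    have h3 := (Finset.sum_eq_zero_iff_of_nonneg (fun φ hφ => by
      have hφ' := hfin.mem_toFinset.1 hφ
      exact mul_nonneg (sub_nonneg.2 (he φ hφ').1) (hd φ hφ').1.le)).1 h2 ψ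
        (hfin.mem_toFinset.2 hψ)
    have h4 : e ψ = 1 := by
      rcases mul_eq_zero.1 h3 with h | h
      · linarith
      · exact absurd h (hd ψ hψ).1.ne'
    rw [(he ψ hψ).2, h4]; simp
  tfae_finish
end

section
/- Let G be a finite group with an automorphism τ ∈ Aut(G) such that τ² = 1 and ∑_{ψ ∈ Irr(G)} ψ(1) = #{g ∈ G : g·τ(g) = 1}. Suppose G has no class-preserving outer automorphisms. Then: (i) the image of τ in Out(G) = Aut(G)/Inn(G) is central; and (ii) if G has a generalized involution model with respect to some automorphism υ with υ² = 1, then G has a generalized involution model with respect to τ. -/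
open scoped Classical BigOperators
open CategoryTheory

open Representation Module

/-- The characters decompose. -/
lemma mem_irr_of_irreducible {G V : Type} [Group G] [Fintype G] [AddCommGroup V] [Module ℂ V]
    [FiniteDimensional ℂ V] (ρ : Representation ℂ G V) [IsIrreducible ρ] :
    ρ.character ∈ irrCharSet G := by
  refine ⟨FDRep.of ρ, ?_, rfl⟩
  have : Invertible (Nat.card G : ℂ) := invertibleOfNonzero (by simp)
  rw [FDRep.simple_iff_char_is_norm_one]
  have h := char_orthonormal ρ ρ
  rw [if_pos ⟨Representation.Equiv.refl ρ⟩] at h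
  have h0 : (Nat.card G : ℂ) ≠ 0 := by simp
  have : ∑ g : G, ρ.character g * ρ.character g⁻¹ = Nat.card G := by
    field_simp at h; simpa using h
  exact this

lemma char_decomp_aux {G : Type} [Group G] [Fintype G] (n : ℕ) :
    ∀ (V : Type) [AddCommGroup V] [Module ℂ V] [FiniteDimensional ℂ V]
      (ρ : Representation ℂ G V), finrank ℂ V = n →
      ∃ s : Multiset (G → ℂ), (∀ ψ ∈ s, ψ ∈ irrCharSet G) ∧ ρ.character = s.sum := by
  induction n using Nat.strong_induction_on with
  | _ n ih =>
  intro V _ _ _ ρ hn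
  by_cases hirr : IsIrreducible ρ
  · exact ⟨{ρ.character}, by simpa using mem_irr_of_irreducible ρ, by simp⟩
  by_cases hs : Subsingleton V
  · refine ⟨0, by simp, ?_⟩
    ext g
    have : ρ g = 0 := Subsingleton.elim _ _
    simp [character, this]
  have hnt : Nontrivial V := not_subsingleton_iff_nontrivial.mp hs
  have hnt' : Nontrivial (Subrepresentation ρ) := by
    refine ⟨⊥, ⊤, fun h => ?_⟩
    have := congrArg Subrepresentation.toSubmodule h
    exact bot_ne_top (α := Submodule ℂ V) this
  obtain ⟨N, hN1, hN2⟩ : ∃ N : Subrepresentation ρ, N ≠ ⊥ ∧ N ≠ ⊤ := by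
    by_contra hcon
    push Not at hcon
    exact hirr ⟨fun N => or_iff_not_imp_left.mpr (hcon N)⟩
  have : NeZero (Nat.card G : ℂ) := ⟨by simp⟩
  obtain ⟨M, hM⟩ := exists_isCompl N
  have hc : IsCompl N.toSubmodule M.toSubmodule := by
    constructor
    · rw [disjoint_iff]
      exact congrArg Subrepresentation.toSubmodule hM.inf_eq_bot
    · rw [codisjoint_iff]
      exact congrArg Subrepresentation.toSubmodule hM.sup_eq_top
  have hadd := Submodule.finrank_add_eq_of_isCompl hc
  have p1 : 0 < finrank ℂ N.toSubmodule := by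
    rw [Nat.pos_iff_ne_zero]
    intro h
    rw [Submodule.finrank_eq_zero] at h
    exact hN1 (Subrepresentation.toSubmodule_injective h)
  have p2 : finrank ℂ N.toSubmodule < finrank ℂ V := by
    apply Submodule.finrank_lt
    intro h
    exact hN2 (Subrepresentation.toSubmodule_injective h)
  obtain ⟨s, hs1, hs2⟩ := ih _ (by omega) N.toSubmodule N.toRepresentation rfl
  obtain ⟨t, ht1, ht2⟩ := ih _ (by omega) M.toSubmodule M.toRepresentation rfl
  refine ⟨s + t, ?_, ?_⟩
  · intro ψ hψ
    rcases Multiset.mem_add.mp hψ with h | h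
    · exact hs1 _ h
    · exact ht1 _ h
  · rw [Multiset.sum_add, ← hs2, ← ht2]
    ext g
    let F : Bool → Submodule ℂ V := fun b => if b then N.toSubmodule else M.toSubmodule
    have hint : DirectSum.IsInternal F := by
      rw [DirectSum.isInternal_submodule_iff_isCompl F (i := true) (j := false) (by simp)
        (by ext b; cases b <;> simp)]
      exact hc
    have hm : ∀ b, Set.MapsTo (ρ g) (F b) (F b) := by
      intro b
      cases b
      · exact M.apply_mem_toSubmodule g
      · exact N.apply_mem_toSubmodule g
    have := LinearMap.trace_eq_sum_trace_restrict hint hm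
    rw [Fintype.sum_bool] at this
    exact this

lemma reg_decomp {G : Type} [Group G] [Fintype G] :
    ∃ s : Multiset (G → ℂ), (∀ ψ ∈ s, ψ ∈ irrCharSet G) ∧
      (fun x : G => if x = 1 then (Fintype.card G : ℂ) else 0) = s.sum := by
  obtain ⟨s, h1, h2⟩ := char_decomp_aux _ (G → ℂ) (TannakaDuality.FiniteGroup.leftRegular (k := ℂ) (G := G)) rfl
  refine ⟨s, h1, ?_⟩
  rw [← h2]
  ext x
  rw [character, LinearMap.trace_eq_matrix_trace ℂ (Pi.basisFun ℂ G), Matrix.trace]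
  simp only [Matrix.diag, LinearMap.toMatrix_apply, Pi.basisFun_apply, Pi.basisFun_repr,
    TannakaDuality.FiniteGroup.leftRegular_apply, Pi.single_apply, mul_eq_right, inv_eq_one]
  split_ifs <;> simp

lemma irr_orth {G : Type} [Group G] [Fintype G] {ψ φ : G → ℂ} (hψ : ψ ∈ irrCharSet G)
    (hφ : φ ∈ irrCharSet G) :
    (Fintype.card G : ℂ)⁻¹ * ∑ g : G, ψ g * φ g⁻¹ = if ψ = φ then 1 else 0 := by
  obtain ⟨V, hV, rfl⟩ := hψ
  obtain ⟨W, hW, rfl⟩ := hφ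
  have : Invertible (Nat.card G : ℂ) := invertibleOfNonzero (by simp)
  have h := FDRep.char_orthonormal V W
  have h' := FDRep.char_orthonormal V V
  rw [if_pos ⟨Iso.refl _⟩] at h'
  rw [Nat.card_eq_fintype_card] at h h'
  dsimp only
  by_cases hi : Nonempty (V ≅ W)
  · rw [h, if_pos hi, if_pos (by obtain ⟨i⟩ := hi; rw [FDRep.char_iso i])]
  · rw [if_neg hi] at h
    by_cases he : (fun g => V.character g) = fun g => W.character g
    · exfalso
      have : ∀ g, V.character g = W.character g := fun g => congrFun he g
      simp_rw [← this] at h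
      rw [h] at h'
      simp at h'
    · rw [if_neg he, h]

lemma irr_one {G : Type} [Group G] [Fintype G] {ψ : G → ℂ} (hψ : ψ ∈ irrCharSet G) :
    ∃ n : ℕ, 0 < n ∧ ψ 1 = n := by
  have h := irr_orth hψ hψ
  obtain ⟨V, hV, rfl⟩ := hψ
  refine ⟨finrank ℂ V, ?_, FDRep.char_one V⟩
  rw [Nat.pos_iff_ne_zero]
  intro h0
  have hs : Subsingleton V := finrank_zero_iff.mp h0
  have : ∀ g, V.character g = 0 := fun g => by
    have : V.ρ g = 0 := Subsingleton.elim _ _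
    simp [FDRep.character, this]
  simp [this] at h

lemma reg_decomp' {G : Type} [Group G] [Fintype G] :
    (irrCharSet G).Finite ∧ ∀ S : Finset (G → ℂ), (↑S = irrCharSet G) → ∀ x : G,
      ∑ ψ ∈ S, ψ 1 * ψ x = if x = 1 then (Fintype.card G : ℂ) else 0 := by
  obtain ⟨s, h1, h2⟩ := reg_decomp (G := G)
  have hG : (Fintype.card G : ℂ) ≠ 0 := by simp
  have key : ∀ φ ∈ irrCharSet G, (s.count φ : ℂ) = φ 1 := by
    intro φ hφ
    have e1 : (Fintype.card G : ℂ)⁻¹ * ∑ g : G, s.sum g * φ g⁻¹ = φ 1 := by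
      rw [← h2]; simp [hG]
    have e2 : ∀ t : Multiset (G → ℂ), (∀ ψ ∈ t, ψ ∈ irrCharSet G) →
        (Fintype.card G : ℂ)⁻¹ * ∑ g : G, t.sum g * φ g⁻¹ = t.count φ := by
      intro t
      induction t using Multiset.induction with
      | empty => simp
      | cons a t ih =>
        intro ht
        have ha := irr_orth (ht a (by simp)) hφ
        have := ih (fun ψ hψ => ht ψ (by simp [hψ]))
        rw [Multiset.sum_cons]
        simp only [Pi.add_apply, add_mul, Finset.sum_add_distrib, mul_add, this, ha]
        rw [Multiset.count_cons]
        push_cast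
        rw [add_comm]
        simp [eq_comm]
    rw [← e2 s h1, e1]
  have hmem : ∀ φ, φ ∈ s ↔ φ ∈ irrCharSet G := by
    intro φ
    refine ⟨h1 φ, fun h => ?_⟩
    have := key φ h
    obtain ⟨n, hn, hn'⟩ := irr_one h
    rw [hn'] at this
    have : s.count φ = n := by exact_mod_cast this
    rw [← Multiset.count_pos]; omega
  have hset : (↑s.toFinset : Set (G → ℂ)) = irrCharSet G := by
    ext φ; simp [hmem]
  refine ⟨hset ▸ Finset.finite_toSet _, fun S hS x => ?_⟩
  have : S = s.toFinset := by
    rw [← Finset.coe_inj, hS, hset]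
  subst this
  have h3 := congrFun h2 x
  rw [Finset.sum_multiset_count] at h3
  simp only [Finset.sum_apply] at h3
  rw [h3]
  refine Finset.sum_congr rfl fun ψ hψ => ?_
  rw [← key ψ (by simpa [hmem] using hψ)]
  simp

/-- Schur: an endomorphism commuting with the action is scalar, phrased on traces. -/
lemma schur_trace {G : Type} [Group G] [Fintype G] (V : FDRep ℂ G) [Simple V]
    (A : V →ₗ[ℂ] V) (hA : ∀ g, A ∘ₗ V.ρ g = V.ρ g ∘ₗ A) : ∃ c : ℂ, A = c • LinearMap.id := by
  have hf := FDRep.finrank_hom_simple_simple V V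
  rw [if_pos ⟨Iso.refl _⟩] at hf
  let a : V ⟶ V := ⟨InducedCategory.homMk (ModuleCat.ofHom A), fun g => by
    ext x
    exact LinearMap.congr_fun (hA g) x⟩
  have h1 : (𝟙 V : V ⟶ V) ≠ 0 := id_nonzero V
  obtain ⟨c, hc⟩ := (finrank_eq_one_iff_of_nonzero' _ h1).mp hf a
  refine ⟨c, ?_⟩
  have := congrArg (fun f : V ⟶ V => f.hom.hom.hom) hc
  exact this.symm


/-- Trace form of Schur's lemma. -/
lemma schur_mul {G : Type} [Group G] [Fintype G] (V : FDRep ℂ G) [Simple V]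
    (A B : V →ₗ[ℂ] V) (hA : ∀ g, A ∘ₗ V.ρ g = V.ρ g ∘ₗ A) :
    V.character 1 * LinearMap.trace ℂ V (A * B) =
      LinearMap.trace ℂ V A * LinearMap.trace ℂ V B := by
  obtain ⟨c, rfl⟩ := schur_trace V A hA
  have : (c • LinearMap.id : V →ₗ[ℂ] V) * B = c • B := by ext; simp
  rw [this, FDRep.char_one]
  simp only [map_smul, LinearMap.trace_id, smul_eq_mul]
  ring

lemma irr_central {G : Type} [Group G] [Fintype G] {ψ : G → ℂ} (hψ : ψ ∈ irrCharSet G)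
    {z : G} (hz : ∀ g, z * g = g * z) (y : G) : ψ 1 * ψ (z * y) = ψ z * ψ y := by
  obtain ⟨V, hV, rfl⟩ := hψ
  have := schur_mul V (V.ρ z) (V.ρ y) (fun g => by
    change V.ρ z * V.ρ g = V.ρ g * V.ρ z
    rw [← map_mul, ← map_mul, hz])
  rw [← map_mul] at this
  exact this

lemma irr_class_avg {G : Type} [Group G] [Fintype G] {ψ : G → ℂ} (hψ : ψ ∈ irrCharSet G)
    (x y : G) : ψ 1 * ∑ g : G, ψ (g * x * g⁻¹ * y) = (Fintype.card G : ℂ) * (ψ x * ψ y) := by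
  obtain ⟨V, hV, rfl⟩ := hψ
  have h := schur_mul V (∑ g : G, V.ρ (g * x * g⁻¹)) (V.ρ y) (fun k => by
    change (∑ g : G, V.ρ (g * x * g⁻¹)) * V.ρ k = V.ρ k * (∑ g : G, V.ρ (g * x * g⁻¹))
    rw [Finset.sum_mul, Finset.mul_sum]
    rw [← Equiv.sum_comp (Equiv.mulLeft k)]
    refine Finset.sum_congr rfl fun g _ => ?_
    rw [← map_mul, ← map_mul]
    congr 1
    simp only [Equiv.coe_mulLeft]
    group)
  rw [Finset.sum_mul, map_sum, map_sum] at h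
  simp_rw [← map_mul] at h
  have e : ∀ g, LinearMap.trace ℂ V (V.ρ (g * x * g⁻¹)) = V.character x :=
    fun g => FDRep.char_conj V x g
  simp_rw [e] at h
  rw [Finset.sum_const, Finset.card_univ, nsmul_eq_mul, mul_assoc] at h
  exact h

lemma irr_separate {G : Type} [Group G] [Fintype G] {x y : G}
    (h : ∀ ψ ∈ irrCharSet G, ψ x = ψ y) : IsConj x y := by
  obtain ⟨hf, hr⟩ := reg_decomp' (G := G)
  have hr := hr hf.toFinset (by simp)
  have hG : (Fintype.card G : ℂ) ≠ 0 := by simp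
  have key : ∀ a b : G, ∑ g : G, (if g * a * g⁻¹ * b = 1 then (Fintype.card G : ℂ) else 0) =
      ∑ ψ ∈ hf.toFinset, (Fintype.card G : ℂ) * (ψ a * ψ b) := by
    intro a b
    simp_rw [← hr]
    rw [Finset.sum_comm]
    refine Finset.sum_congr rfl fun ψ hψ => ?_
    rw [← Finset.mul_sum, irr_class_avg (by simpa using hψ)]
  have e : ∑ g : G, (if g * x * g⁻¹ * y⁻¹ = 1 then (Fintype.card G : ℂ) else 0) =
      ∑ g : G, (if g * y * g⁻¹ * y⁻¹ = 1 then (Fintype.card G : ℂ) else 0) := by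
    rw [key, key]
    refine Finset.sum_congr rfl fun ψ hψ => ?_
    rw [h ψ (by simpa using hψ)]
  by_contra hcon
  rw [Finset.sum_eq_zero, ← Finset.sum_filter, Finset.sum_const, nsmul_eq_mul] at e
  · have := (mul_eq_zero.mp e.symm).resolve_right hG
    rw [Nat.cast_eq_zero, Finset.card_eq_zero] at this
    have h1 : (1 : G) ∈ Finset.univ.filter (fun g : G => g * y * g⁻¹ * y⁻¹ = 1) := by simp
    rw [this] at h1
    simp at h1
  · intro g _
    rw [if_neg]
    intro hg
    exact hcon (isConj_iff.mpr ⟨g, mul_inv_eq_one.mp hg⟩)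

lemma trace_swap {V : Type} [AddCommGroup V] [Module ℂ V] [FiniteDimensional ℂ V]
    (f g : V →ₗ[ℂ] V) :
    LinearMap.trace ℂ (TensorProduct ℂ V V)
      ((TensorProduct.comm ℂ V V).toLinearMap ∘ₗ TensorProduct.map f g) =
      LinearMap.trace ℂ V (f * g) := by
  let b := Module.finBasis ℂ V
  rw [LinearMap.trace_eq_matrix_trace ℂ (b.tensorProduct b), LinearMap.trace_eq_matrix_trace ℂ b,
    LinearMap.toMatrix_mul, Matrix.trace, Matrix.trace, Fintype.sum_prod_type]
  rw [Finset.sum_comm]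
  refine Finset.sum_congr rfl fun i _ => ?_
  simp only [Matrix.diag, Matrix.mul_apply, LinearMap.toMatrix_apply]
  refine Finset.sum_congr rfl fun j _ => ?_
  simp

/-- The twisted Frobenius–Schur indicator. -/
noncomputable def fsInd {G : Type} [Group G] [Fintype G] (τ : G ≃* G) (ψ : G → ℂ) : ℂ :=
  (Fintype.card G : ℂ)⁻¹ * ∑ g : G, ψ (g * τ g)

lemma fsInd_cases {G : Type} [Group G] [Fintype G] (τ : G ≃* G) (hτ : ∀ g, τ (τ g) = g)
    {ψ : G → ℂ} (hψ : ψ ∈ irrCharSet G) :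
    fsInd τ ψ = 0 ∨ ((fsInd τ ψ = 1 ∨ fsInd τ ψ = -1) ∧ ∀ g, ψ (τ g) = ψ g⁻¹) := by
  obtain ⟨V, hV, rfl⟩ := hψ
  have hinv : Invertible (Nat.card G : ℂ) := invertibleOfNonzero (by simp)
  have hinv' : Invertible (Fintype.card G : ℂ) := invertibleOfNonzero (by simp)
  let ρ : Representation ℂ G V := V.ρ
  let ρ' : Representation ℂ G V := ρ.comp τ.toMonoidHom
  let W : FDRep ℂ G := FDRep.of ρ'.dual
  have hWc : ∀ g, W.character g = V.character (τ g⁻¹) := fun g => char_dual ρ' g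
  have hW : Simple W := by
    rw [FDRep.simple_iff_char_is_norm_one] at hV ⊢
    rw [← hV]
    simp_rw [hWc]
    rw [← Equiv.sum_comp ((Equiv.inv G).trans τ.toEquiv) (fun g => V.character g * V.character g⁻¹)]
    simp
  let T : Representation ℂ G (TensorProduct ℂ V V) := ρ.tprod ρ'
  let P := T.averageMap
  let s : TensorProduct ℂ V V →ₗ[ℂ] TensorProduct ℂ V V := (TensorProduct.comm ℂ V V).toLinearMap
  have hP : LinearMap.IsProj T.invariants P := isProj_averageMap T
  have hPe : P = (Fintype.card G : ℂ)⁻¹ • ∑ g : G, TensorProduct.map (ρ g) (ρ (τ g)) := by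
    change T.averageMap = _
    simp [averageMap, GroupAlgebra.average]
    rfl
  have hε : LinearMap.trace ℂ _ (s ∘ₗ P) = fsInd τ (fun g => V.character g) := by
    rw [hPe, LinearMap.comp_smul, map_smul, fsInd, smul_eq_mul,
      ← Module.End.mul_eq_comp, Finset.mul_sum, map_sum]
    congr 1
    refine Finset.sum_congr rfl fun g _ => ?_
    rw [Module.End.mul_eq_comp, trace_swap, ← map_mul]
    rfl
  have hdim : (finrank ℂ T.invariants : ℂ) = if Nonempty (V ≅ W) then 1 else 0 := by
    rw [← FDRep.char_orthonormal V W, ← card_inv_mul_sum_char_eq_finrank]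
    congr 1
    refine Finset.sum_congr rfl fun g _ => ?_
    rw [hWc, inv_inv]
    exact congrFun (char_tensor ρ ρ') g
  by_cases hi : Nonempty (V ≅ W)
  · right
    refine ⟨?_, ?_⟩
    · rw [if_pos hi] at hdim
      have hd : finrank ℂ T.invariants = 1 := by exact_mod_cast hdim
      obtain ⟨u, hu0, hu⟩ := finrank_eq_one_iff'.mp hd
      have hs : ∀ v ∈ T.invariants, s v ∈ T.invariants := by
        intro v hv g
        have h1 := hv (τ g)
        have h2 : T g (s v) = s (T (τ g) v) := by
          change TensorProduct.map (ρ g) (ρ (τ g)) (TensorProduct.comm ℂ V V v) =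
            TensorProduct.comm ℂ V V (TensorProduct.map (ρ (τ g)) (ρ (τ (τ g))) v)
          rw [hτ, TensorProduct.map_comm]
        rw [h2, h1]
      obtain ⟨c, hc⟩ := hu ⟨s u, hs u u.2⟩
      have hc' : s (u : TensorProduct ℂ V V) = c • (u : TensorProduct ℂ V V) :=
        (congrArg Subtype.val hc).symm
      have hss : ∀ v, s (s v) = v := fun v => by
        change TensorProduct.comm ℂ V V (TensorProduct.comm ℂ V V v) = v
        simp
      have hcc : c * c = 1 := by
        have h1 := hss u
        rw [hc', map_smul, hc', smul_smul] at h1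
        have h2 : (c * c - 1) • (u : TensorProduct ℂ V V) = 0 := by
          rw [sub_smul, h1, one_smul, sub_self]
        rcases smul_eq_zero.mp h2 with h | h
        · exact sub_eq_zero.mp h
        · exact absurd (Subtype.ext h) hu0
      have hsP : s ∘ₗ P = c • P := by
        ext1
        apply LinearMap.ext
        intro w
        apply LinearMap.ext
        intro w'
        obtain ⟨d, hd⟩ := hu ⟨P (w ⊗ₜ[ℂ] w'), hP.map_mem _⟩
        have hd' : d • (u : TensorProduct ℂ V V) = P (w ⊗ₜ[ℂ] w') := congrArg Subtype.val hd
        change s (P (w ⊗ₜ[ℂ] w')) = c • P (w ⊗ₜ[ℂ] w')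
        rw [← hd', map_smul, hc', smul_comm]
      rw [hsP, map_smul, hP.trace, hd] at hε
      rw [← hε]
      simpa using mul_self_eq_one_iff.mp hcc
    · obtain ⟨i⟩ := hi
      intro g
      have := congrFun (FDRep.char_iso i) g⁻¹
      rw [hWc, inv_inv] at this
      exact this.symm
  · left
    rw [if_neg hi] at hdim
    have hd : finrank ℂ T.invariants = 0 := by exact_mod_cast hdim
    rw [Submodule.finrank_eq_zero] at hd
    have : P = 0 := by
      apply LinearMap.ext
      intro v
      have := hP.map_mem v
      rw [hd] at this
      simpa using this
    rw [← hε, this]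
    simp

lemma count_formula {G : Type} [Group G] [Fintype G] (τ : G ≃* G) {S : Finset (G → ℂ)}
    (hS : ↑S = irrCharSet G) {z : G} (hz : ∀ g, z * g = g * z) :
    (Nat.card {g : G // g * τ g = z} : ℂ) = ∑ ψ ∈ S, fsInd τ ψ * ψ z⁻¹ := by
  have hr := reg_decomp'.2 S hS
  have hG : (Fintype.card G : ℂ) ≠ 0 := by simp
  have hz' : ∀ g, z⁻¹ * g = g * z⁻¹ := fun g => (Commute.inv_left (hz g : Commute z g)).eq
  have e : ∑ g : G, (if z⁻¹ * (g * τ g) = 1 then (Fintype.card G : ℂ) else 0) =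
      ∑ ψ ∈ S, (Fintype.card G : ℂ) * (fsInd τ ψ * ψ z⁻¹) := by
    simp_rw [← hr]
    rw [Finset.sum_comm]
    refine Finset.sum_congr rfl fun ψ hψ => ?_
    have hψ' : ψ ∈ irrCharSet G := by rw [← hS]; exact hψ
    simp_rw [irr_central hψ' hz']
    rw [← Finset.mul_sum, fsInd]
    field_simp
  rw [← Finset.sum_filter, Finset.sum_const, nsmul_eq_mul, ← Finset.mul_sum, mul_comm] at e
  rw [← mul_left_cancel₀ hG e, Nat.card_eq_fintype_card, Fintype.card_subtype]
  congr 2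
  ext g
  simp only [Finset.mem_filter, Finset.mem_univ, true_and, inv_mul_eq_one]
  exact eq_comm

/-- The main consequence of the degree sum condition. -/
lemma fsInd_eq_one {G : Type} [Group G] [Fintype G] (τ : G ≃* G) (hτ : ∀ g, τ (τ g) = g)
    (hsum : (∑ᶠ ψ ∈ irrCharSet G, ψ 1) = (Nat.card {g : G // g * τ g = 1} : ℂ)) :
    ∀ ψ ∈ irrCharSet G, fsInd τ ψ = 1 := by
  have hf := (reg_decomp' (G := G)).1
  have hS : (↑hf.toFinset : Set (G → ℂ)) = irrCharSet G := by simp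
  rw [count_formula τ hS (by simp), finsum_mem_eq_finite_toFinset_sum _ hf] at hsum
  have h0 : ∑ ψ ∈ hf.toFinset, ((1 - fsInd τ ψ) * ψ 1).re = 0 := by
    rw [← Complex.re_sum]
    simp only [sub_mul, one_mul, Finset.sum_sub_distrib]
    rw [hsum]
    simp
  have hc : ∀ ψ ∈ hf.toFinset, (fsInd τ ψ = 0 ∨ fsInd τ ψ = 1 ∨ fsInd τ ψ = -1) ∧
      ∃ n : ℕ, 0 < n ∧ ψ 1 = n := by
    intro ψ hψ
    have hψ' : ψ ∈ irrCharSet G := by simpa using hψ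
    refine ⟨?_, irr_one hψ'⟩
    rcases fsInd_cases τ hτ hψ' with h | ⟨h, -⟩
    · exact Or.inl h
    · exact Or.inr h
  rw [Finset.sum_eq_zero_iff_of_nonneg] at h0
  · intro ψ hψ
    have hψ' : ψ ∈ hf.toFinset := by simpa using hψ
    obtain ⟨h, n, hn, hn'⟩ := hc ψ hψ'
    have := h0 ψ hψ'
    rw [hn'] at this
    rcases h with h | h | h
    · rw [h] at this; simp at this; omega
    · exact h
    · rw [h] at this; norm_num at this; omega
  · intro ψ hψ
    obtain ⟨h, n, hn, hn'⟩ := hc ψ hψ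
    rw [hn']
    rcases h with h | h | h <;> rw [h] <;> norm_num

lemma conj_inv_of_sum {G : Type} [Group G] [Fintype G] (τ : G ≃* G) (hτ : ∀ g, τ (τ g) = g)
    (hsum : (∑ᶠ ψ ∈ irrCharSet G, ψ 1) = (Nat.card {g : G // g * τ g = 1} : ℂ)) (x : G) :
    IsConj (τ x) x⁻¹ := by
  apply irr_separate
  intro ψ hψ
  rcases fsInd_cases τ hτ hψ with h | ⟨-, h⟩
  · rw [fsInd_eq_one τ hτ hsum ψ hψ] at h
    simp at h
  · exact h x

lemma central_eq_one {G : Type} [Group G] [Fintype G] {S : Finset (G → ℂ)}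
    (hS : ↑S = irrCharSet G) {z : G} (hz : ∀ g, z * g = g * z)
    (h : ∑ ψ ∈ S, ψ z = ∑ ψ ∈ S, ψ 1) : z = 1 := by
  have hn : ∀ ψ ∈ irrCharSet G, ‖ψ z‖ = ‖ψ 1‖ := by
    intro ψ hψ
    obtain ⟨n, hn, hn'⟩ := irr_one hψ
    have hne : ψ 1 ≠ 0 := by rw [hn']; exact_mod_cast hn.ne'
    have hp : ∀ k : ℕ, ψ (z ^ k) = ψ 1 * (ψ z / ψ 1) ^ k := by
      intro k
      induction k with
      | zero => simp
      | succ k ih =>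
        have := irr_central hψ hz (z ^ k)
        rw [← pow_succ', ih] at this
        apply mul_left_cancel₀ hne
        rw [this, pow_succ]
        field_simp
    have h1 := hp (Fintype.card G)
    rw [pow_card_eq_one] at h1
    have h2 : (ψ z / ψ 1) ^ Fintype.card G = 1 := by
      apply mul_left_cancel₀ hne
      rw [← h1, mul_one]
    have h3 := Complex.norm_eq_one_of_pow_eq_one h2 Fintype.card_ne_zero
    rw [norm_div, div_eq_one_iff_eq (by simpa using hne)] at h3
    exact h3
  have hle : ∀ ψ ∈ irrCharSet G, (ψ z).re ≤ (ψ 1).re := by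
    intro ψ hψ
    obtain ⟨n, _, hn'⟩ := irr_one hψ
    have := Complex.re_le_norm (ψ z)
    rw [hn ψ hψ, hn'] at this
    rw [hn']
    simpa using this
  have hre : ∀ ψ ∈ S, (ψ z).re = (ψ 1).re := by
    rw [← Finset.sum_eq_sum_iff_of_le (fun ψ hψ => hle ψ (by rw [← hS]; exact hψ))]
    rw [← Complex.re_sum, ← Complex.re_sum, h]
  have heq : ∀ ψ ∈ S, ψ z = ψ 1 := by
    intro ψ hψ
    have hψ' : ψ ∈ irrCharSet G := by rw [← hS]; exact hψ
    obtain ⟨n, _, hn'⟩ := irr_one hψ'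
    have h1 := hre ψ hψ
    have h2 := hn ψ hψ'
    rw [hn'] at h1 h2 ⊢
    have h3 : ‖ψ z‖ = (ψ z).re := by rw [h1, h2]; simp
    have h4 := Complex.re_eq_norm.mp h3.symm
    apply Complex.ext
    · exact h1
    · simpa using (Complex.nonneg_iff.mp h4).2.symm
  have hr := reg_decomp'.2 S hS
  have e : ∑ ψ ∈ S, ψ 1 * ψ z = ∑ ψ ∈ S, ψ 1 * ψ 1 :=
    Finset.sum_congr rfl fun ψ hψ => by rw [heq ψ hψ]
  rw [hr, hr] at e
  by_contra hne
  rw [if_neg hne, if_pos rfl] at e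
  exact (by simp : (Fintype.card G : ℂ) ≠ 0) e.symm

lemma gim_sum {G : Type} [Group G] [Fintype G] (υ : G ≃* G) (hυ : ∀ g, υ (υ g) = g)
    (h : HasGIMwrt G υ) :
    (∑ᶠ ψ ∈ irrCharSet G, ψ 1) = (Nat.card {g : G // g * υ g = 1} : ℂ) := by
  obtain ⟨R, lam, h1, h2, h3⟩ := h
  rw [← h3 1]
  have a1 : ∀ ω, indChar (twistedCent υ ω) (fun h => lam ω h) 1 =
      (Nat.card (twistedCent υ ω) : ℂ)⁻¹ * Fintype.card G := by
    intro ω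
    rw [indChar]
    congr 1
    have : ∀ x : G, x⁻¹ * 1 * x = 1 := fun x => by simp
    have e : ∀ x : G, (if h : x⁻¹ * 1 * x ∈ twistedCent υ ω then
        lam ω ⟨x⁻¹ * 1 * x, h⟩ else 0) = 1 := by
      intro x
      rw [dif_pos (by rw [this]; exact one_mem _)]
      rw [← map_one (lam ω)]
      congr 1
      exact Subtype.ext (this x)
    simp_rw [e]
    simp
  simp_rw [a1]
  let I : Finset G := Finset.univ.filter fun v => v * υ v = 1
  have hI : (Nat.card {g : G // g * υ g = 1} : ℂ) = ∑ v ∈ I, (1 : ℂ) := by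
    rw [Nat.card_eq_fintype_card, Fintype.card_subtype]; simp [I]
  rw [hI]
  -- the number of `g` moving `v` to `ω`
  have hfib : ∀ v ω : G, (∃ g : G, g * v * (υ g)⁻¹ = ω) →
      (Finset.univ.filter fun g : G => g * v * (υ g)⁻¹ = ω).card = Nat.card (twistedCent υ ω) := by
    rintro v ω ⟨g, hg⟩
    rw [← Fintype.card_subtype, ← Nat.card_eq_fintype_card]
    refine Nat.card_congr ⟨fun k => ⟨k.1 * g⁻¹, ?_⟩, fun c => ⟨c.1 * g, ?_⟩, ?_, ?_⟩
    · change k.1 * g⁻¹ * ω * (υ (k.1 * g⁻¹))⁻¹ = ω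
      obtain ⟨k, hk⟩ := k
      refine Eq.trans ?_ hk
      subst hg
      simp only [map_mul, map_inv]
      group
    · have hc : c.1 * ω * (υ c.1)⁻¹ = ω := c.2
      obtain ⟨c, hc'⟩ := c
      refine Eq.trans ?_ hc
      subst hg
      simp only [map_mul]
      group
    · intro k; simp
    · intro c; simp
  have hone : ∀ v ∈ I, (1 : ℂ) = ∑ ω ∈ R, (Nat.card (twistedCent υ ω) : ℂ)⁻¹ *
      ∑ g : G, if g * v * (υ g)⁻¹ = ω then 1 else 0 := by
    intro v hv
    obtain ⟨ω, ⟨hω, hg⟩, huniq⟩ := h2 v (by simpa [I] using hv)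
    rw [Finset.sum_eq_single_of_mem ω hω]
    · rw [Finset.sum_boole, hfib v ω hg, inv_mul_cancel₀]
      simp
    · intro ω' hω' hne
      rw [Finset.sum_eq_zero, mul_zero]
      intro g _
      rw [if_neg]
      intro hg'
      exact hne (huniq ω' ⟨hω', g, hg'⟩)
  rw [Finset.sum_congr rfl hone, Finset.sum_comm]
  refine Finset.sum_congr rfl fun ω hω => ?_
  rw [← Finset.mul_sum]
  congr 1
  rw [Finset.sum_comm]
  have : ∀ g : G, ∑ v ∈ I, (if g * v * (υ g)⁻¹ = ω then (1 : ℂ) else 0) = 1 := by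
    intro g
    have hmem : g⁻¹ * ω * υ g ∈ I := by
      have := h1 ω hω
      simp only [I, Finset.mem_filter, Finset.mem_univ, true_and, map_mul, map_inv, hυ]
      calc g⁻¹ * ω * υ g * ((υ g)⁻¹ * υ ω * g) = g⁻¹ * (ω * υ ω) * g := by group
        _ = 1 := by rw [this]; group
    rw [Finset.sum_eq_single_of_mem _ hmem]
    · rw [if_pos (by group)]
    · intro v _ hne
      rw [if_neg]
      intro hg
      apply hne
      rw [← hg]
      group
  simp_rw [this]
  simp

lemma indChar_congr {G : Type} [Group G] [Fintype G] {H K : Subgroup G} (e : H = K)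
    (lam : K →* ℂ) (x : G) :
    indChar H (fun h => (lam.comp (Subgroup.inclusion e.le)) h) x = indChar K (fun h => lam h) x := by
  subst e
  rfl

/-- If `G` has no class-preserving outer automorphisms and the twisted involution
count matches the character degree sum for `τ`, then the image of `τ` in `Out(G)`
is central, and any generalized involution model for `G` can be defined with
respect to `τ`. -/
theorem gim_transfer (G : Type) [Group G] [Fintype G] (τ : G ≃* G)
    (hτ : ∀ g, τ (τ g) = g)
    (hsum : (∑ᶠ ψ ∈ irrCharSet G, ψ 1) = (Nat.card {g : G // g * τ g = 1} : ℂ))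
    (hncp : ∀ σ : G ≃* G, (∀ g : G, IsConj g (σ g)) →
      ∃ h : G, ∀ g : G, σ g = h * g * h⁻¹) :
    (∀ σ : G ≃* G, ∃ h : G, ∀ g : G, τ (σ (τ.symm (σ.symm g))) = h * g * h⁻¹) ∧
    (∀ υ : G ≃* G, (∀ g, υ (υ g) = g) → HasGIMwrt G υ → HasGIMwrt G τ) := by
  have hc := conj_inv_of_sum τ hτ hsum
  refine ⟨?_, ?_⟩
  · intro σ
    have map_conj : ∀ (f : G ≃* G) {a b : G}, IsConj a b → IsConj (f a) (f b) :=
      fun f a b h => f.toMonoidHom.map_isConj h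
    obtain ⟨h, hh⟩ := hncp (((σ.symm.trans τ.symm).trans σ).trans τ) (by
      intro g
      change IsConj g (τ (σ (τ.symm (σ.symm g))))
      have hs : ∀ x, τ.symm x = τ x := fun x => by rw [MulEquiv.symm_apply_eq, hτ]
      rw [hs]
      have h1 := map_conj τ (map_conj σ (hc (σ.symm g)))
      rw [map_inv, MulEquiv.apply_symm_apply] at h1
      have h2 := hc g⁻¹
      rw [inv_inv] at h2
      exact (h1.trans h2).symm)
    exact ⟨h, hh⟩
  · intro υ hυ hgim
    have hsum' := gim_sum υ hυ hgim
    have hc' := conj_inv_of_sum υ hυ hsum'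
    obtain ⟨h, hh⟩ := hncp (τ.trans υ) (by
      intro g
      change IsConj g (υ (τ g))
      have h1 := υ.toMonoidHom.map_isConj (hc g)
      have h2 := hc' g⁻¹
      rw [inv_inv] at h2
      exact (h1.trans h2).symm)
    have hυτ : ∀ g, υ g = h * τ g * h⁻¹ := by
      intro g
      have := hh (τ g)
      rwa [MulEquiv.trans_apply, hτ] at this
    have hz : ∀ g, (h * τ h) * g = g * (h * τ h) := by
      intro g
      have := hυ g
      rw [hυτ, hυτ] at this
      simp only [map_mul, map_inv, hτ] at this
      conv_rhs => rw [← this]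
      group
    have hrel : ∀ ω, (ω * h) * τ (ω * h) = (ω * υ ω) * (h * τ h) := by
      intro ω
      rw [hυτ, map_mul]
      group
    have hcard : Nat.card {g : G // g * υ g = 1} = Nat.card {g : G // g * τ g = h * τ h} := by
      refine Nat.card_congr ((Equiv.mulRight h).subtypeEquiv ?_)
      intro ω
      change _ ↔ ω * h * τ (ω * h) = _
      rw [hrel, mul_eq_right]
    have hf := (reg_decomp' (G := G)).1
    have hS : (↑hf.toFinset : Set (G → ℂ)) = irrCharSet G := by simp
    have hz1 : h * τ h = 1 := by
      rw [← inv_eq_one]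
      apply central_eq_one hS (fun g => (Commute.inv_left (hz g : Commute (h * τ h) g)).eq)
      rw [← finsum_mem_eq_finite_toFinset_sum (fun ψ : G → ℂ => ψ 1) hf, hsum', hcard,
        count_formula τ hS hz]
      refine Finset.sum_congr rfl fun ψ hψ => ?_
      rw [fsInd_eq_one τ hτ hsum ψ (by simpa using hψ), one_mul]
    have hcent : ∀ ω, twistedCent τ ω = twistedCent υ (ω * h⁻¹) := by
      intro ω
      ext g
      change g * ω * (τ g)⁻¹ = ω ↔ g * (ω * h⁻¹) * (υ g)⁻¹ = ω * h⁻¹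
      rw [hυτ, ← mul_left_inj h⁻¹]
      have : g * (ω * h⁻¹) * (h * τ g * h⁻¹)⁻¹ = g * ω * (τ g)⁻¹ * h⁻¹ := by group
      rw [this]
    obtain ⟨R, lam, h1, h2, h3⟩ := hgim
    refine ⟨R.image (· * h), fun ω => (lam (ω * h⁻¹)).comp (Subgroup.inclusion (hcent ω).le),
      ?_, ?_, ?_⟩
    · intro ω hω
      obtain ⟨ω', hω', rfl⟩ := Finset.mem_image.mp hω
      rw [hrel, h1 ω' hω', hz1, one_mul]
    · intro v hv
      have hact : ∀ g, g * (v * h⁻¹) * (υ g)⁻¹ * h = g * v * (τ g)⁻¹ := by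
        intro g
        rw [hυτ]
        group
      obtain ⟨ω, ⟨hω, g, hg⟩, hu⟩ := h2 (v * h⁻¹) (by
        have := hrel (v * h⁻¹)
        rw [inv_mul_cancel_right, hv, hz1, mul_one] at this
        exact this.symm)
      refine ⟨ω * h, ⟨Finset.mem_image_of_mem _ hω, g, ?_⟩, ?_⟩
      · rw [← hact, hg]
      · rintro ω' ⟨hω', g', hg'⟩
        obtain ⟨ω'', hω'', rfl⟩ := Finset.mem_image.mp hω'
        have := hu ω'' ⟨hω'', g', by
          rw [← hact] at hg'
          exact mul_right_cancel hg'⟩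
        rw [this]
    · intro x
      rw [← h3 x, Finset.sum_image (by intro a _ b _ hab; exact mul_right_cancel hab)]
      refine Finset.sum_congr rfl fun ω _ => ?_
      rw [indChar_congr (hcent (ω * h)), mul_inv_cancel_right]
end
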